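/- arXiv:2512.08136 — 4 statements merged into one kernel-verified Lean document; each statement's English description precedes it below -/
import Mathlib

section
/- Let p̲ and p̄ be real numbers with 0 ≤ p̲ < p̄ and p̲ < 1. Then there exists a unique real number v* satisfying ∫₀¹ max{x − p̲, v* − p̄, 0} dx = v* − p̲, and this v* satisfies p̲ < v* < 1 + p̄ − p̲. -/
/-- For `0 ≤ p̲ < p̄` with `p̲ < 1`, there exists a unique real `v*` satisfying
`∫₀¹ max{x − p̲, v* − p̄, 0} dx = v* − p̲`, and it satisfies `p̲ < v* < 1 + p̄ − p̲`. -/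
theorem stmt_2 (pl ph : ℝ) (h0 : 0 ≤ pl) (h1 : pl < ph) (h2 : pl < 1) :
    (∃! v : ℝ, (∫ x in (0:ℝ)..1, max (max (x - pl) (v - ph)) 0) = v - pl) ∧
    ∀ v : ℝ, (∫ x in (0:ℝ)..1, max (max (x - pl) (v - ph)) 0) = v - pl →
      pl < v ∧ v < 1 + ph - pl := by
  have hc : ∀ v : ℝ, Continuous fun x : ℝ => max (max (x - pl) (v - ph)) 0 := by
    intro v; fun_prop
  have hpos : ∀ v : ℝ, 0 < ∫ x in (0:ℝ)..1, max (max (x - pl) (v - ph)) 0 := by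
    intro v
    have := intervalIntegral.integral_lt_integral_of_continuousOn_of_le_of_exists_lt
      (f := fun _ : ℝ => (0:ℝ)) (g := fun x : ℝ => max (max (x - pl) (v - ph)) 0)
      (zero_lt_one) continuousOn_const (hc v).continuousOn
      (fun x _ => le_max_right _ _)
      ⟨1, by simp, lt_max_of_lt_left (lt_max_of_lt_left (by linarith))⟩
    simpa using this
  have hbig : ∀ v : ℝ, 1 + ph - pl ≤ v →
      (∫ x in (0:ℝ)..1, max (max (x - pl) (v - ph)) 0) < v - pl := by
    intro v hv
    have : (∫ x in (0:ℝ)..1, max (max (x - pl) (v - ph)) 0) = ∫ x in (0:ℝ)..1, (v - ph) := by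
      apply intervalIntegral.integral_congr
      intro x hx
      rw [Set.uIcc_of_le zero_le_one] at hx
      have := hx.2
      show max (max (x - pl) (v - ph)) 0 = v - ph
      rw [max_eq_right (show x - pl ≤ v - ph by linarith), max_eq_left (by linarith)]
    rw [this]
    simp
    linarith
  have hb : ∀ v : ℝ, (∫ x in (0:ℝ)..1, max (max (x - pl) (v - ph)) 0) = v - pl →
      pl < v ∧ v < 1 + ph - pl := by
    intro v hv
    constructor
    · have := hpos v
      linarith
    · by_contra h
      have := hbig v (not_lt.mp h)
      linarith
  have hlt : ∀ v w : ℝ, v < w → w < 1 + ph - pl →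
      (∫ x in (0:ℝ)..1, max (max (x - pl) (w - ph)) 0) <
      (∫ x in (0:ℝ)..1, max (max (x - pl) (v - ph)) 0) + (w - v) := by
    intro v w hvw hw
    have := intervalIntegral.integral_lt_integral_of_continuousOn_of_le_of_exists_lt
      (f := fun x : ℝ => max (max (x - pl) (w - ph)) 0)
      (g := fun x : ℝ => max (max (x - pl) (v - ph)) 0 + (w - v))
      (zero_lt_one) (hc w).continuousOn ((hc v).add continuous_const).continuousOn
      (fun x _ => by
        have a := le_max_left (max (x - pl) (v - ph)) 0
        have b := le_max_right (max (x - pl) (v - ph)) 0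
        have c := le_max_left (x - pl) (v - ph)
        have d := le_max_right (x - pl) (v - ph)
        exact max_le (max_le (by linarith) (by linarith)) (by linarith))
      ⟨1, by simp, by
        have a := le_max_left (max (1 - pl) (v - ph)) 0
        have c := le_max_left (1 - pl) (v - ph)
        exact max_lt (max_lt (by linarith) (by linarith)) (by linarith)⟩
    rw [intervalIntegral.integral_add ((hc v).intervalIntegrable _ _)
      (continuous_const.intervalIntegrable _ _)] at this
    simpa using this
  refine ⟨?_, hb⟩
  have hF : Continuous fun v : ℝ =>
      (∫ x in (0:ℝ)..1, max (max (x - pl) (v - ph)) 0) - (v - pl) := by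
    refine Continuous.sub ?_ (by fun_prop)
    apply intervalIntegral.continuous_parametric_intervalIntegral_of_continuous'
    simp only [Function.uncurry_def]
    fun_prop
  obtain ⟨v, -, hv⟩ := intermediate_value_Icc' (show pl ≤ 1 + ph - pl by linarith)
    hF.continuousOn
    (show (0:ℝ) ∈ Set.Icc _ _ from
      ⟨by have := hbig (1 + ph - pl) le_rfl; linarith, by have := hpos pl; linarith⟩)
  have hv' : (∫ x in (0:ℝ)..1, max (max (x - pl) (v - ph)) 0) = v - pl := sub_eq_zero.mp hv
  refine ⟨v, hv', ?_⟩
  intro w hw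
  have hw : (∫ x in (0:ℝ)..1, max (max (x - pl) (w - ph)) 0) = w - pl := hw
  rcases lt_trichotomy w v with h | h | h
  · have := hlt w v h (hb v hv').2
    linarith
  · exact h
  · have := hlt v w h (hb w hw).2
    linarith
end

section
/- Let c ≥ 0 and x ∈ [0,1] satisfy 2c(1 − x) ≤ 1, and let p*, Δp be arbitrary real numbers. Define v₁ = 1 − Δp − √(2c(1 − x)). Then v₁ − p* + Δp = −c(1 − x) + ∫₀¹ max{v₂ − p*, v₁ − p* + Δp} dv₂. -/
/-- With `c ≥ 0`, `x ∈ [0,1]`, `2c(1−x) ≤ 1`, the cutoff `v₁ = 1 − Δp − √(2c(1−x))`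
satisfies the indifference condition
`v₁ − p* + Δp = −c(1−x) + ∫₀¹ max{v₂ − p*, v₁ − p* + Δp} dv₂`. -/
theorem stmt_6 (c x p dp v₁ : ℝ) (hc : 0 ≤ c) (hx : x ∈ Set.Icc (0:ℝ) 1)
    (h : 2 * c * (1 - x) ≤ 1) (hv : v₁ = 1 - dp - Real.sqrt (2 * c * (1 - x))) :
    v₁ - p + dp = -(c * (1 - x)) + ∫ v₂ in (0:ℝ)..1, max (v₂ - p) (v₁ - p + dp) := by
  have hn : 0 ≤ 2 * c * (1 - x) := mul_nonneg (by linarith) (by linarith [hx.2])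
  have hs := Real.sq_sqrt hn
  have hs0 := Real.sqrt_nonneg (2 * c * (1 - x))
  have hs1 : Real.sqrt (2 * c * (1 - x)) ≤ 1 := Real.sqrt_le_one.mpr h
  generalize Real.sqrt (2 * c * (1 - x)) = s at *
  have hcont : Continuous fun v₂ : ℝ => max (v₂ - p) (v₁ - p + dp) := by fun_prop
  rw [← intervalIntegral.integral_add_adjacent_intervals
    (hcont.intervalIntegrable 0 (1 - s)) (hcont.intervalIntegrable (1 - s) 1)]
  have h1 : ∫ v₂ in (0:ℝ)..(1 - s), max (v₂ - p) (v₁ - p + dp)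
      = ∫ v₂ in (0:ℝ)..(1 - s), (v₁ - p + dp) := by
    apply intervalIntegral.integral_congr
    intro y hy
    rw [Set.uIcc_of_le (by linarith)] at hy
    exact max_eq_right (by linarith [hy.2])
  have h2 : ∫ v₂ in (1 - s)..1, max (v₂ - p) (v₁ - p + dp)
      = ∫ v₂ in (1 - s)..1, (v₂ - p) := by
    apply intervalIntegral.integral_congr
    intro y hy
    rw [Set.uIcc_of_le (by linarith)] at hy
    exact max_eq_left (by linarith [hy.1])
  rw [h1, h2, intervalIntegral.integral_const,
    intervalIntegral.integral_sub (by simp) (by simp),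
    intervalIntegral.integral_const, integral_id, smul_eq_mul, smul_eq_mul, hv]
  linear_combination (-1 / 2) * hs
end

section
/- Let c ≥ 0 and x ∈ [0,1] satisfy 2cx ≤ 1, and let p*, Δp be arbitrary real numbers. Define v₂ = 1 + Δp − √(2cx). Then v₂ − p* = −cx + ∫₀¹ max{v₁ − p* + Δp, v₂ − p*} dv₁. -/
/-- With `c ≥ 0`, `x ∈ [0,1]`, `2cx ≤ 1`, the cutoff `v₂ = 1 + Δp − √(2cx)`
satisfies the indifference condition
`v₂ − p* = −cx + ∫₀¹ max{v₁ − p* + Δp, v₂ − p*} dv₁`. -/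
theorem stmt_7 (c x p dp v₂ : ℝ) (hc : 0 ≤ c) (hx : x ∈ Set.Icc (0:ℝ) 1)
    (h : 2 * c * x ≤ 1) (hv : v₂ = 1 + dp - Real.sqrt (2 * c * x)) :
    v₂ - p = -(c * x) + ∫ v₁ in (0:ℝ)..1, max (v₁ - p + dp) (v₂ - p) := by
  have hcx : 0 ≤ 2 * c * x := by
    have := mul_nonneg hc hx.1
    linarith
  have hs0 := Real.sqrt_nonneg (2 * c * x)
  have hs2 := Real.sq_sqrt hcx
  have hs1 : Real.sqrt (2 * c * x) ≤ 1 := Real.sqrt_le_one.mpr h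
  generalize Real.sqrt (2 * c * x) = s at *
  have hcont : Continuous fun v₁ : ℝ => max (v₁ - p + dp) (v₂ - p) := by fun_prop
  have h1 : ∫ v₁ in (0:ℝ)..(1 - s), max (v₁ - p + dp) (v₂ - p)
      = ∫ v₁ in (0:ℝ)..(1 - s), (v₂ - p) := by
    apply intervalIntegral.integral_congr
    intro v hv'
    rw [Set.uIcc_of_le (by linarith)] at hv'
    exact max_eq_right (by linarith [hv'.2])
  have h2 : ∫ v₁ in (1 - s)..1, max (v₁ - p + dp) (v₂ - p)
      = ∫ v₁ in (1 - s)..1, (v₁ + (dp - p)) := by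
    apply intervalIntegral.integral_congr
    intro v hv'
    rw [Set.uIcc_of_le (by linarith)] at hv'
    have := max_eq_left (a := v - p + dp) (b := v₂ - p) (by linarith [hv'.1])
    simp only [this]
    ring
  have h3 : ∫ v₁ in (1 - s)..1, (v₁ + (dp - p))
      = (1 ^ 2 - (1 - s) ^ 2) / 2 + (1 - (1 - s)) * (dp - p) := by
    rw [intervalIntegral.integral_add (f := fun v : ℝ => v) (continuous_id.intervalIntegrable _ _)
      (continuous_const.intervalIntegrable _ _)]
    simp [integral_id]
    ring
  rw [← intervalIntegral.integral_add_adjacent_intervals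
    (hcont.intervalIntegrable 0 (1 - s)) (hcont.intervalIntegrable (1 - s) 1), h1, h2, h3,
    intervalIntegral.integral_const, smul_eq_mul, hv]
  linear_combination (-1 / 2) * hs2
end

section
/- Let c > 0 and define g : ℝ × ℝ → ℝ by g(x, d) = c(1 − x)·d + (1/3)(2c(1 − x))^{3/2} + cx·d − (1/3)(2cx)^{3/2} − (1/6)d³. Suppose X : ℝ → ℝ is differentiable at d₀, X(d₀) = x₀ with 0 < x₀ < 1, and g(X(d), d) = 0 for all d in some neighborhood of d₀. Then the derivative of X at d₀ equals (c − ½d₀²) / (½(2c)^{3/2}(√(1 − x₀) + √(x₀))). -/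
/-- Implicit-function-theorem formula for the derivative of the location cutoff:
if `g(x,d) = c(1−x)d + (1/3)(2c(1−x))^{3/2} + cxd − (1/3)(2cx)^{3/2} − (1/6)d³` and
`g(X(d), d) = 0` near `d₀`, with `X` differentiable at `d₀`, `X(d₀) = x₀ ∈ (0,1)`, then
`X′(d₀) = (c − ½d₀²) / (½(2c)^{3/2}(√(1−x₀) + √x₀))`. -/
theorem stmt_13 (c : ℝ) (hc : 0 < c) (g : ℝ × ℝ → ℝ)
    (hg : ∀ x d : ℝ, g (x, d) =
      c * (1 - x) * d + (1/3) * (2 * c * (1 - x)) ^ ((3:ℝ)/2)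
        + c * x * d - (1/3) * (2 * c * x) ^ ((3:ℝ)/2) - (1/6) * d ^ 3)
    (X : ℝ → ℝ) (d₀ x₀ : ℝ) (hX : DifferentiableAt ℝ X d₀) (hX0 : X d₀ = x₀)
    (hx0 : 0 < x₀) (hx1 : x₀ < 1)
    (hzero : ∀ᶠ d in nhds d₀, g (X d, d) = 0) :
    deriv X d₀ =
      (c - (1/2) * d₀ ^ 2) /
        ((1/2) * (2 * c) ^ ((3:ℝ)/2) * (Real.sqrt (1 - x₀) + Real.sqrt x₀)) := by
  subst hX0
  have hD := hX.hasDerivAt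
  set X' := deriv X d₀ with hX'
  have h2c : (0:ℝ) < 2 * c := by linarith
  have h1x : 0 < 1 - X d₀ := by linarith
  have hp1 : 0 < 2 * c * (1 - X d₀) := mul_pos h2c h1x
  have hp2 : 0 < 2 * c * X d₀ := mul_pos h2c hx0
  have hA := (hD.const_sub 1).const_mul (2 * c)
  have hB := hD.const_mul (2 * c)
  have hA' := (hA.rpow_const (p := (3:ℝ)/2) (Or.inl hp1.ne')).const_mul (1/3)
  have hB' := (hB.rpow_const (p := (3:ℝ)/2) (Or.inl hp2.ne')).const_mul (1/3)
  have hL := (hasDerivAt_id d₀).const_mul c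
  have hC := (hasDerivAt_pow 3 d₀).const_mul (1/6 : ℝ)
  have hF := ((hL.add hA').sub hB').sub hC
  have hz : HasDerivAt (fun _ : ℝ => (0:ℝ)) 0 d₀ := hasDerivAt_const _ _
  have hF0 := hF.unique (hz.congr_of_eventuallyEq (by
    filter_upwards [hzero] with d hd
    rw [hg] at hd
    simp only [Pi.add_apply, Pi.sub_apply, id]
    linarith))
  have e : (3:ℝ)/2 - 1 = 1/2 := by norm_num
  have h32 : (2 * c) ^ ((3:ℝ)/2) = 2 * c * Real.sqrt (2 * c) := by
    rw [show (3:ℝ)/2 = 1 + 1/2 by norm_num, Real.rpow_add h2c, Real.rpow_one,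
      Real.sqrt_eq_rpow]
  rw [e, ← Real.sqrt_eq_rpow, ← Real.sqrt_eq_rpow, Real.sqrt_mul h2c.le,
    Real.sqrt_mul h2c.le] at hF0
  have s0 := Real.sqrt_pos.2 h2c
  have s1 := Real.sqrt_pos.2 h1x
  have s2 := Real.sqrt_pos.2 hx0
  rw [h32, eq_div_iff (by positivity)]
  push_cast at hF0
  norm_num only at hF0
  linarith
end
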